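/- For Λ = k₀Λ₀+k₁Λ₁+k₂Λ₂ realized with highest weight vector v_Λ = v_{Λ₀}^{⊗k₀} ⊗ v_{Λ₁}^{⊗k₁} ⊗ v_{Λ₂}^{⊗k₂}, the componentwise simple current operator satisfies [ω]v_Λ = C·x_{2̲}(−1)^{k₁} x₀(−1)^{k₂} x₂(−1)^{k₁} (v_{Λ₁}^{⊗k₀} ⊗ v_{Λ₀}^{⊗k₁} ⊗ v_{Λ₂}^{⊗k₂}) for some nonzero constant C, and consequently [ω]²v_Λ = C_Λ·x_{2̲}(−2)^{k₁} x₀(−2)^{k₂} x₂(−2)^{k₁} x_{2̲}(−1)^{k₀} x₀(−1)^{k₂} x₂(−1)^{k₀} v_Λ for some C_Λ ≠ 0. -/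

import Mathlib

/-!
STATEMENT 17 (Primc, equations (5.3) and (7.1)).

For `Λ = k₀Λ₀+k₁Λ₁+k₂Λ₂` realized with highest weight vector
`v_Λ = v_{Λ₀}^{⊗k₀} ⊗ v_{Λ₁}^{⊗k₁} ⊗ v_{Λ₂}^{⊗k₂}`, the componentwise simple
current operator satisfies
`[ω]v_Λ = C·x_{2̲}(−1)^{k₁} x₀(−1)^{k₂} x₂(−1)^{k₁}
           (v_{Λ₁}^{⊗k₀} ⊗ v_{Λ₀}^{⊗k₁} ⊗ v_{Λ₂}^{⊗k₂})`
for some nonzero constant `C`, and consequently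
`[ω]²v_Λ = C_Λ·x_{2̲}(−2)^{k₁} x₀(−2)^{k₂} x₂(−2)^{k₁}
             x_{2̲}(−1)^{k₀} x₀(−1)^{k₂} x₂(−1)^{k₀} v_Λ`
for some `C_Λ ≠ 0`.

Following the paper, the tensor product is realized inside the symmetric
algebra `S(L(Λ₀) ⊕ L(Λ₁) ⊕ L(Λ₂))`, axiomatized below as a commutative
`ℂ`-algebra `A` on which `g̃₁` acts by commuting derivations `x_γ(n)`
(`γ ∈ Γ = {2̲, 0, 2}`), with an algebra automorphism `[ω]` satisfying
`x_γ(n)[ω] = [ω]x_γ(n+1)`, elements `v₀, v₁, v₂` (the level `1` highest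
weight vectors), the simple current values `[ω]v₀ = v₁`,
`[ω]v₁ = x_{2̲}(−1)x₂(−1)v₀`, `[ω]v₂ = x₀(−1)v₂` (with proper normalizations),
and the level `1` relations of Lemmas 4.1–4.3; then
`v_Λ = v₀^{k₀}v₁^{k₁}v₂^{k₂}` and `v_{Λ*} = v₀^{k₁}v₁^{k₀}v₂^{k₂}`.
-/

/-- The three "colors" `Γ = {2̲, 0, 2}`, i.e. the roots `ε₁−ε₂`, `ε₁`, `ε₁+ε₂`
of `B₂` spanning the graded piece `g₁`. -/
inductive Gamma : Type
  | u2 : Gamma  -- `2̲ = ε₁ − ε₂`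
  | z0 : Gamma  -- `0 = ε₁`
  | p2 : Gamma  -- `2 = ε₁ + ε₂`
  deriving DecidableEq

/-- The symmetric-algebra realization
`L(Λ) ⊆ S^k(L(Λ₀) ⊕ L(Λ₁) ⊕ L(Λ₂))` of tensor products of level `1`
fundamental `B₂⁽¹⁾`-modules:  `g̃₁` acts by commuting derivations, the
componentwise simple current operator `[ω] = S([ω])` is an algebra
automorphism, and the level `1` highest weight vectors `v₀, v₁, v₂` obey the
simple current identities and the initial-condition relations of
Lemmas 4.1–4.3 of the paper. -/
structure SymAlgSetting where
  A : Type
  [commRing : CommRing A]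
  [algebra : Algebra ℂ A]
  /-- the action of `x_γ(n)`, `γ ∈ Γ`, by derivations of the symmetric algebra -/
  x : Gamma → ℤ → Derivation ℂ A A
  /-- `g̃₁` is commutative -/
  comm : ∀ γ δ m n (w : A), x γ m (x δ n w) = x δ n (x γ m w)
  /-- the simple current operator `[ω]`, an automorphism of the symmetric algebra -/
  Ω : A ≃ₐ[ℂ] A
  /-- `x_γ(n)[ω] = [ω]x_γ(n+1)` -/
  shift : ∀ γ n (w : A), x γ n (Ω w) = Ω (x γ (n + 1) w)
  /-- the highest weight vectors `v_{Λ₀}, v_{Λ₁}, v_{Λ₂}` of the level `1`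
  fundamental modules -/
  v0 : A
  v1 : A
  v2 : A
  /-- `[ω]v_{Λ₀} = v_{Λ₁}` -/
  omega_v0 : Ω v0 = v1
  /-- `[ω]v_{Λ₁} = x_{2̲}(−1)x₂(−1)v_{Λ₀}` -/
  omega_v1 : Ω v1 = x Gamma.u2 (-1) (x Gamma.p2 (-1) v0)
  /-- `[ω]v_{Λ₂} = x₀(−1)v_{Λ₂}` -/
  omega_v2 : Ω v2 = x Gamma.z0 (-1) v2
  /-- Lemma 4.1: `x_γ(−1)v_{Λ₁} = 0` -/
  ann_v1 : ∀ γ, x γ (-1) v1 = 0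
  /-- Lemma 4.2 (1),(2),(4) on `v_{Λ₀}` -/
  ann_v0_p2p2 : x Gamma.p2 (-1) (x Gamma.p2 (-1) v0) = 0
  ann_v0_u2u2 : x Gamma.u2 (-1) (x Gamma.u2 (-1) v0) = 0
  ann_v0_z0p2 : x Gamma.z0 (-1) (x Gamma.p2 (-1) v0) = 0
  ann_v0_u2z0 : x Gamma.u2 (-1) (x Gamma.z0 (-1) v0) = 0
  ann_v0_z0cube : x Gamma.z0 (-1) (x Gamma.z0 (-1) (x Gamma.z0 (-1) v0)) = 0
  /-- Lemma 4.3 on `v_{Λ₂}` -/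
  ann_v2_p2 : x Gamma.p2 (-1) v2 = 0
  ann_v2_u2u2 : x Gamma.u2 (-1) (x Gamma.u2 (-1) v2) = 0
  ann_v2_u2z0 : x Gamma.u2 (-1) (x Gamma.z0 (-1) v2) = 0
  ann_v2_z0z0 : x Gamma.z0 (-1) (x Gamma.z0 (-1) v2) = 0

attribute [instance] SymAlgSetting.commRing SymAlgSetting.algebra

namespace SymAlgSetting

variable (S : SymAlgSetting)

/-- the highest weight vector `v_Λ = v_{Λ₀}^{k₀} v_{Λ₁}^{k₁} v_{Λ₂}^{k₂}` of
`L(Λ)`, `Λ = k₀Λ₀+k₁Λ₁+k₂Λ₂` -/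
def vLam (k₀ k₁ k₂ : ℕ) : S.A := S.v0 ^ k₀ * S.v1 ^ k₁ * S.v2 ^ k₂

/-- the derivation `x_γ(n)` as a linear endomorphism -/
def xEnd (γ : Gamma) (n : ℤ) : Module.End ℂ S.A := (S.x γ n).toLinearMap

end SymAlgSetting

theorem der_pow_aux {A : Type} [CommRing A] [Algebra ℂ A] (D : Derivation ℂ A A) (a : A)
    (ha : D (D a) = 0) (n : ℕ) : ∀ b : A, D b = 0 →
    ((D.toLinearMap : Module.End ℂ A) ^ n) (a ^ n * b) = (n.factorial : ℂ) • ((D a) ^ n * b) := by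
  induction n with
  | zero => intro b _; simp
  | succ n ih =>
    intro b hb
    have h1 : D (a ^ (n + 1) * b) = ((n + 1 : ℕ) : ℂ) • (a ^ n * (D a * b)) := by
      rw [Derivation.leibniz, hb, Derivation.leibniz_pow, Nat.cast_smul_eq_nsmul]
      simp only [smul_eq_mul, nsmul_eq_mul, Nat.add_sub_cancel]
      ring
    have h2 : D (D a * b) = 0 := by
      rw [Derivation.leibniz, hb, ha]; simp
    rw [pow_succ, Module.End.mul_apply]
    change ((D.toLinearMap : Module.End ℂ A) ^ n) (D (a ^ (n + 1) * b)) = _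
    rw [h1, map_smul, ih _ h2, smul_smul, Nat.factorial_succ, Nat.cast_mul, pow_succ, mul_assoc]

theorem omega_pow_aux (S : SymAlgSetting) (γ : Gamma) (m n : ℤ) (h : n + 1 = m) (k : ℕ) :
    ∀ w : S.A, S.Ω ((S.xEnd γ m ^ k) w) = (S.xEnd γ n ^ k) (S.Ω w) := by
  subst h
  induction k with
  | zero => intro w; simp
  | succ k ih =>
    intro w
    rw [pow_succ, pow_succ, Module.End.mul_apply, Module.End.mul_apply, ih]
    congr 1
    exact (S.shift γ n w).symm

theorem first_aux (k₀ k₁ k₂ : ℕ) (S : SymAlgSetting) :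
    (∃ C : ℂ, C ≠ 0 ∧
      S.Ω (S.vLam k₀ k₁ k₂)
        = C • ((S.xEnd Gamma.u2 (-1) ^ k₁ * S.xEnd Gamma.z0 (-1) ^ k₂ *
            S.xEnd Gamma.p2 (-1) ^ k₁) (S.vLam k₁ k₀ k₂))) := by
  have pw : ∀ (γ : Gamma) (a : S.A) (n : ℕ), S.x γ (-1) a = 0 → S.x γ (-1) (a ^ n) = 0 := by
    intro γ a n h
    rw [Derivation.leibniz_pow, h]; simp
  have ml : ∀ (γ : Gamma) (a b : S.A), S.x γ (-1) a = 0 → S.x γ (-1) b = 0 →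
      S.x γ (-1) (a * b) = 0 := by
    intro γ a b h h'
    rw [Derivation.leibniz, h, h']; simp
  have e1 := der_pow_aux (S.x Gamma.p2 (-1)) S.v0 S.ann_v0_p2p2 k₁ (S.v1 ^ k₀ * S.v2 ^ k₂)
    (ml _ _ _ (pw _ _ _ (S.ann_v1 _)) (pw _ _ _ S.ann_v2_p2))
  have e2 := der_pow_aux (S.x Gamma.z0 (-1)) S.v2 S.ann_v2_z0z0 k₂
    ((S.x Gamma.p2 (-1) S.v0) ^ k₁ * S.v1 ^ k₀)
    (ml _ _ _ (pw _ _ _ S.ann_v0_z0p2) (pw _ _ _ (S.ann_v1 _)))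
  have e3 := der_pow_aux (S.x Gamma.u2 (-1)) (S.x Gamma.p2 (-1) S.v0)
    (by rw [S.comm Gamma.u2 Gamma.p2, S.comm Gamma.u2 Gamma.p2, S.ann_v0_u2u2, map_zero]) k₁
    (S.v1 ^ k₀ * (S.x Gamma.z0 (-1) S.v2) ^ k₂)
    (ml _ _ _ (pw _ _ _ (S.ann_v1 _)) (pw _ _ _ S.ann_v2_u2z0))
  have hc : ((k₁.factorial : ℂ) * k₂.factorial * k₁.factorial) ≠ 0 := by
    simp [Nat.factorial_ne_zero]
  refine ⟨((k₁.factorial : ℂ) * k₂.factorial * k₁.factorial)⁻¹, inv_ne_zero hc, ?_⟩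
  rw [eq_inv_smul_iff₀ hc]
  simp only [SymAlgSetting.vLam, SymAlgSetting.xEnd, Module.End.mul_apply, map_mul, map_pow,
    S.omega_v0, S.omega_v1, S.omega_v2]
  rw [mul_assoc (S.v0 ^ k₁), e1, map_smul,
    show (S.x Gamma.p2 (-1) S.v0) ^ k₁ * (S.v1 ^ k₀ * S.v2 ^ k₂)
      = S.v2 ^ k₂ * ((S.x Gamma.p2 (-1) S.v0) ^ k₁ * S.v1 ^ k₀) by ring, e2, map_smul, map_smul,
    show (S.x Gamma.z0 (-1) S.v2) ^ k₂ * ((S.x Gamma.p2 (-1) S.v0) ^ k₁ * S.v1 ^ k₀)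
      = (S.x Gamma.p2 (-1) S.v0) ^ k₁ * (S.v1 ^ k₀ * (S.x Gamma.z0 (-1) S.v2) ^ k₂) by ring, e3,
    smul_smul, smul_smul]
  congr 1
  ring

/-- **Proposition (Primc, (5.3) and (7.1)).**
`[ω]v_Λ = C·x_{2̲}(−1)^{k₁}x₀(−1)^{k₂}x₂(−1)^{k₁}v_{Λ*}` with `C ≠ 0`, where
`Λ* = k₁Λ₀+k₀Λ₁+k₂Λ₂`, and consequently
`[ω]²v_Λ = C_Λ·x_{2̲}(−2)^{k₁}x₀(−2)^{k₂}x₂(−2)^{k₁}x_{2̲}(−1)^{k₀}x₀(−1)^{k₂}x₂(−1)^{k₀}v_Λ`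
with `C_Λ ≠ 0`. -/
theorem simple_current_on_highest_weight_vector (k₀ k₁ k₂ : ℕ)
    (S : SymAlgSetting) :
    (∃ C : ℂ, C ≠ 0 ∧
      S.Ω (S.vLam k₀ k₁ k₂)
        = C • ((S.xEnd Gamma.u2 (-1) ^ k₁ * S.xEnd Gamma.z0 (-1) ^ k₂ *
            S.xEnd Gamma.p2 (-1) ^ k₁) (S.vLam k₁ k₀ k₂))) ∧
    (∃ CΛ : ℂ, CΛ ≠ 0 ∧
      S.Ω (S.Ω (S.vLam k₀ k₁ k₂))
        = CΛ • ((S.xEnd Gamma.u2 (-2) ^ k₁ * S.xEnd Gamma.z0 (-2) ^ k₂ *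
            S.xEnd Gamma.p2 (-2) ^ k₁ * S.xEnd Gamma.u2 (-1) ^ k₀ *
            S.xEnd Gamma.z0 (-1) ^ k₂ * S.xEnd Gamma.p2 (-1) ^ k₀)
              (S.vLam k₀ k₁ k₂))) := by
  refine ⟨first_aux k₀ k₁ k₂ S, ?_⟩
  obtain ⟨C, hC, h⟩ := first_aux k₀ k₁ k₂ S
  obtain ⟨C', hC', h'⟩ := first_aux k₁ k₀ k₂ S
  refine ⟨C * C', mul_ne_zero hC hC', ?_⟩
  rw [h, map_smul]
  simp only [Module.End.mul_apply] at h' ⊢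
  rw [omega_pow_aux S _ (-1) (-2) (by norm_num), omega_pow_aux S _ (-1) (-2) (by norm_num),
    omega_pow_aux S _ (-1) (-2) (by norm_num), h']
  simp only [map_smul, smul_smul]
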